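/- arXiv:1511.04402 — 3 statements merged into one kernel-verified Lean document; each statement's English description precedes it below -/
import Mathlib

section
/- Let X be an n×p real matrix with orthonormal columns (XᵀX = Iₚ), y ∈ ℝⁿ, c = Xᵀy, and λ > 0, and assume c_j² ≠ 2λ for all j. Then the hard-threshold vector β^{L0}, defined by β^{L0}_j = c_j if c_j² > 2λ and β^{L0}_j = 0 otherwise, is the unique global minimizer over ℝᵖ of the L0 objective (1/2)‖y − Xβ‖₂² + λ‖β‖₀. -/
open Matrix Finset

/-- The number of nonzero entries of `β` (the "L0 norm"). -/
noncomputable def l0norm {p : ℕ} (β : Fin p → ℝ) : ℕ :=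
  (Finset.univ.filter (fun j => β j ≠ 0)).card

/-- For `X` with orthonormal columns, `c = Xᵀ y`, `lam > 0`, and `cⱼ² ≠ 2 lam` for all `j`,
the hard-threshold vector (`cⱼ` if `cⱼ² > 2 lam`, else `0`) is the unique global minimizer
of the L0 objective `(1/2)‖y - Xβ‖² + lam‖β‖₀`. -/
theorem l0_orthonormal_hard_threshold (n p : ℕ) (X : Matrix (Fin n) (Fin p) ℝ)
    (hX : Xᵀ * X = 1) (y : Fin n → ℝ) (c : Fin p → ℝ) (hc : c = Xᵀ.mulVec y)
    (lam : ℝ) (hlam : 0 < lam) (hne : ∀ j, (c j)^2 ≠ 2 * lam)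
    (L0 : (Fin p → ℝ) → ℝ)
    (hL0 : ∀ β : Fin p → ℝ,
      L0 β = (1/2) * ∑ i, (y i - X.mulVec β i)^2 + lam * (l0norm β : ℝ))
    (βL0 : Fin p → ℝ) (hβL0 : ∀ j, βL0 j = if (c j)^2 > 2 * lam then c j else 0) :
    (∀ β : Fin p → ℝ, L0 βL0 ≤ L0 β) ∧
    (∀ β : Fin p → ℝ, L0 β = L0 βL0 → β = βL0) := by
  have key : ∀ β : Fin p → ℝ, L0 β = (1/2) * ∑ i, (y i)^2
      + ∑ j, ((β j)^2 / 2 - c j * β j + if β j ≠ 0 then lam else 0) := by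
    intro β
    have h1 : ∑ i, (X.mulVec β i)^2 = ∑ j, (β j)^2 := by
      have : X.mulVec β ⬝ᵥ X.mulVec β = β ⬝ᵥ β := by
        rw [Matrix.dotProduct_mulVec, Matrix.vecMul_mulVec, hX, Matrix.vecMul_one]
      simpa [dotProduct, sq] using this
    have h2 : ∑ i, y i * X.mulVec β i = ∑ j, c j * β j := by
      have : y ⬝ᵥ X.mulVec β = c ⬝ᵥ β := by
        rw [Matrix.dotProduct_mulVec, hc, Matrix.mulVec_transpose]
      simpa [dotProduct] using this
    have h3 : lam * (l0norm β : ℝ) = ∑ j, if β j ≠ 0 then lam else 0 := by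
      rw [← Finset.sum_filter, Finset.sum_const, nsmul_eq_mul, mul_comm]
      rfl
    have h4 : ∑ i, (y i - X.mulVec β i)^2
        = ∑ i, (y i)^2 - 2 * ∑ i, y i * X.mulVec β i + ∑ i, (X.mulVec β i)^2 := by
      rw [Finset.mul_sum, ← Finset.sum_sub_distrib, ← Finset.sum_add_distrib]
      exact Finset.sum_congr rfl fun i _ => by ring
    rw [hL0, h4, h1, h2, h3, Finset.sum_add_distrib, Finset.sum_sub_distrib, ← Finset.sum_div]
    ring
  have strict : ∀ (β : Fin p → ℝ) (j : Fin p), β j ≠ βL0 j →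
      ((βL0 j)^2 / 2 - c j * βL0 j + if βL0 j ≠ 0 then lam else 0)
        < ((β j)^2 / 2 - c j * β j + if β j ≠ 0 then lam else 0) := by
    intro β j h
    have hj := hne j
    rw [hβL0 j] at h ⊢
    by_cases hg : (c j)^2 > 2 * lam
    · have hc0 : c j ≠ 0 := by
        intro h0
        rw [h0] at hg
        norm_num at hg
        linarith
      rw [if_pos hg] at h ⊢
      rw [if_pos hc0]
      by_cases hb : β j = 0
      · simp only [hb, ne_eq, not_true_eq_false, if_false]
        nlinarith
      · rw [if_pos hb]
        have : 0 < (β j - c j)^2 := by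
          have := sub_ne_zero.mpr h
          positivity
        nlinarith
    · rw [if_neg hg] at h ⊢
      rw [if_pos h]
      have : (c j)^2 < 2 * lam := lt_of_le_of_ne (not_lt.mp hg) hj
      simp only [ne_eq, not_true_eq_false, if_false]
      nlinarith [sq_nonneg (β j - c j)]
  have weak : ∀ (β : Fin p → ℝ) (j : Fin p),
      ((βL0 j)^2 / 2 - c j * βL0 j + if βL0 j ≠ 0 then lam else 0)
        ≤ ((β j)^2 / 2 - c j * β j + if β j ≠ 0 then lam else 0) := by
    intro β j
    by_cases h : β j = βL0 j
    · rw [h]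
    · exact (strict β j h).le
  refine ⟨fun β => ?_, fun β hβ => ?_⟩
  · rw [key, key]
    have := Finset.sum_le_sum fun j (_ : j ∈ Finset.univ) => weak β j
    linarith
  · by_contra hcon
    obtain ⟨j, hj⟩ := Function.ne_iff.mp hcon
    have := Finset.sum_lt_sum (fun j (_ : j ∈ Finset.univ) => weak β j)
      ⟨j, Finset.mem_univ j, strict β j hj⟩
    rw [key, key] at hβ
    linarith
end

section
/- Let X be an n×p real matrix with orthonormal columns (XᵀX = Iₚ), y ∈ ℝⁿ, c = Xᵀy, and λ > 2. Let F ⊆ {1, …, p} and let k ∈ F satisfy |c_k| > λ. Then L0(β̂_{F∖{k}}) > L0(β̂_F), where L0(β) = (1/2)‖y − Xβ‖₂² + λ‖β‖₀; that is, removing an index of the Lasso support strictly increases the L0 objective, so the Lass0 update never removes such an index. -/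
open Matrix Finset

/-- The constrained least squares solution for orthonormal columns: `c k` on `F`, `0` off `F`. -/
noncomputable def betaHat {p : ℕ} (c : Fin p → ℝ) (F : Finset (Fin p)) : Fin p → ℝ :=
  fun k => if k ∈ F then c k else 0

lemma rss_eq {n p : ℕ} (X : Matrix (Fin n) (Fin p) ℝ) (hX : Xᵀ * X = 1) (y : Fin n → ℝ)
    (β : Fin p → ℝ) :
    ∑ i, (y i - X.mulVec β i)^2
      = y ⬝ᵥ y - 2 * ((Xᵀ.mulVec y) ⬝ᵥ β) + β ⬝ᵥ β := by
  have h1 : ∑ i, (y i - X.mulVec β i)^2 = (y - X.mulVec β) ⬝ᵥ (y - X.mulVec β) := by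
    simp [dotProduct, sq]
  have h2 : (X.mulVec β) ⬝ᵥ (X.mulVec β) = β ⬝ᵥ β := by
    rw [Matrix.dotProduct_mulVec, Matrix.vecMul_mulVec, hX, Matrix.vecMul_one]
  have h3 : y ⬝ᵥ (X.mulVec β) = (Xᵀ.mulVec y) ⬝ᵥ β := by
    rw [Matrix.dotProduct_mulVec, Matrix.mulVec_transpose]
  rw [h1, sub_dotProduct, dotProduct_sub, dotProduct_sub, dotProduct_comm (X.mulVec β) y, h2, h3]
  ring

lemma dot_betaHat {p : ℕ} (c : Fin p → ℝ) (F : Finset (Fin p)) :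
    c ⬝ᵥ betaHat c F = ∑ j ∈ F, c j ^ 2 := by
  simp [dotProduct, betaHat, sq]

lemma betaHat_dot {p : ℕ} (c : Fin p → ℝ) (F : Finset (Fin p)) :
    betaHat c F ⬝ᵥ betaHat c F = ∑ j ∈ F, c j ^ 2 := by
  simp [dotProduct, betaHat, sq]

lemma l0norm_betaHat {p : ℕ} (c : Fin p → ℝ) (F : Finset (Fin p)) (k : Fin p) (hk : k ∈ F)
    (hck : c k ≠ 0) : l0norm (betaHat c F) = l0norm (betaHat c (F.erase k)) + 1 := by
  unfold l0norm
  rw [← Finset.card_insert_of_notMem (a := k)]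
  · congr 1
    ext j
    by_cases h : j = k
    · subst h; simp [betaHat, hk, hck]
    · simp [betaHat, h]
  · simp [betaHat]

/-- With orthonormal columns, `lam > 2` and `k ∈ F` with `|c k| > lam`, removing `k` from
the support strictly increases the L0 objective. -/
theorem remove_lasso_index_increases_L0 (n p : ℕ) (X : Matrix (Fin n) (Fin p) ℝ)
    (hX : Xᵀ * X = 1) (y : Fin n → ℝ) (c : Fin p → ℝ) (hc : c = Xᵀ.mulVec y)
    (lam : ℝ) (hlam : 2 < lam)
    (L0 : (Fin p → ℝ) → ℝ)
    (hL0 : ∀ β : Fin p → ℝ,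
      L0 β = (1/2) * ∑ i, (y i - X.mulVec β i)^2 + lam * (l0norm β : ℝ))
    (F : Finset (Fin p)) (k : Fin p) (hk : k ∈ F) (hck : |c k| > lam) :
    L0 (betaHat c (F.erase k)) > L0 (betaHat c F) := by
  have hne : c k ≠ 0 := by
    intro h
    rw [h, abs_zero] at hck
    linarith
  have hs := Finset.add_sum_erase F (fun j => c j ^ 2) hk
  have hsq : |c k| ^ 2 = c k ^ 2 := sq_abs _
  rw [hL0, hL0, rss_eq X hX, rss_eq X hX, ← hc, dot_betaHat, dot_betaHat, betaHat_dot,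
    betaHat_dot, l0norm_betaHat c F k hk hne, ← hs]
  push_cast
  nlinarith
end

section
/- Let X be an n×p real matrix with columns x_1, …, x_p, y ∈ ℝⁿ, λ > 0, and suppose x_i = k · x_j for some real scalar k and indices i ≠ j. If β ∈ ℝᵖ is a global minimizer of the L0 objective L0(β) = (1/2)‖y − Xβ‖₂² + λ‖β‖₀, then β_i = 0 or β_j = 0; that is, at most one of any pair of proportional (perfectly correlated) columns is selected. -/
open Matrix Finset

/-- If column `i` of `X` is a scalar multiple of column `j` (`x_i = k·x_j`, `i ≠ j`), then
any global minimizer of the L0 objective has `β_i = 0` or `β_j = 0`. -/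
theorem l0_minimizer_drops_proportional_column (n p : ℕ) (X : Matrix (Fin n) (Fin p) ℝ)
    (y : Fin n → ℝ) (lam : ℝ) (hlam : 0 < lam)
    (i j : Fin p) (hij : i ≠ j) (k : ℝ) (hcol : ∀ r, X r i = k * X r j)
    (L0 : (Fin p → ℝ) → ℝ)
    (hL0 : ∀ b : Fin p → ℝ,
      L0 b = (1/2) * ∑ r, (y r - X.mulVec b r)^2 + lam * (l0norm b : ℝ))
    (β : Fin p → ℝ) (hmin : ∀ b : Fin p → ℝ, L0 β ≤ L0 b) :
    β i = 0 ∨ β j = 0 := by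
  by_contra hcon
  push Not at hcon
  obtain ⟨hi, hj⟩ := hcon
  set b : Fin p → ℝ := β + Pi.single j (k * β i) - Pi.single i (β i) with hb
  have hX : X.mulVec b = X.mulVec β := by
    ext r
    simp only [hb, Matrix.mulVec_sub, Matrix.mulVec_add, Matrix.mulVec_single, Pi.sub_apply,
      Pi.add_apply]
    simp [hcol]
    ring
  have hlt : l0norm b < l0norm β := by
    unfold l0norm
    apply Finset.card_lt_card
    rw [Finset.ssubset_iff_of_subset]
    · refine ⟨i, by simpa using hi, ?_⟩
      simp [hb, hij]
    · intro m hm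
      simp only [Finset.mem_filter, Finset.mem_univ, true_and] at hm ⊢
      intro h0
      apply hm
      have h1 : m ≠ i := by rintro rfl; exact hi h0
      have h2 : m ≠ j := by rintro rfl; exact hj h0
      simp [hb, h0, h1, h2]
  have h := hmin b
  rw [hL0, hL0, hX] at h
  have h3 : (l0norm b : ℝ) < l0norm β := by exact_mod_cast hlt
  have h4 := mul_lt_mul_of_pos_left h3 hlam
  linarith
end
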